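/- Let ξ = exp(2πi/11), ν = (−1+i√11)/2, ℤ[ν] = {a + bν : a, b ∈ ℤ} ⊂ ℂ, for k ∈ ℤ let v_k = (ξ^k, ξ^{9k}, ξ^{3k}, ξ^{4k}, ξ^{5k}) ∈ ℂ⁵, and for k ∈ ℤ let ℓ_k : ℂ⁵ → ℂ be the linear form ℓ_k(z) = ξ^k z₁ + ξ^{9k} z₂ + ξ^{3k} z₃ + ξ^{4k} z₄ + ξ^{5k} z₅. Then the set Λ₄ = {z ∈ ℂ⁵ : ℓ_k(z) ∈ ℤ[ν] for k = 0, 1, 2, 3, 4} is equal to the ℤ[ν]-module (ℤ[ν]/(1+2ν))(v₀−v₁) + (ℤ[ν]/(1+2ν))(v₁−v₂) + (ℤ[ν]/(1+2ν))(v₂−v₃) + (ℤ[ν]/(1+2ν))(v₃−v₄) + ℤ[ν]v₀, where (ℤ[ν]/(1+2ν))w denotes the set of vectors (c/(1+2ν))·w with c ∈ ℤ[ν]. -/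

import Mathlib

/-- ξ = exp(2πi/11), a primitive 11th root of unity. -/
noncomputable def ξ : ℂ := Complex.exp (2 * Real.pi * Complex.I / 11)

/-- ν = (−1 + i√11)/2. -/
noncomputable def ν : ℂ := (-1 + Complex.I * Real.sqrt 11) / 2

/-- ℤ[ν] = {a + bν : a, b ∈ ℤ} ⊂ ℂ. -/
noncomputable def Zν : Set ℂ := {z | ∃ a b : ℤ, z = (a : ℂ) + (b : ℂ) * ν}

/-- v_k = (ξ^k, ξ^{9k}, ξ^{3k}, ξ^{4k}, ξ^{5k}) ∈ ℂ⁵. -/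
noncomputable def v (k : ℕ) : Fin 5 → ℂ := fun i => ξ ^ (k * ![1, 9, 3, 4, 5] i)

theorem isPrimitiveRoot_ξ : IsPrimitiveRoot ξ 11 := by
  simpa [ξ] using Complex.isPrimitiveRoot_exp 11 (by norm_num)

theorem ξ_geom_sum : 1 + ξ + ξ ^ 2 + ξ ^ 3 + ξ ^ 4 + ξ ^ 5 + ξ ^ 6 + ξ ^ 7 + ξ ^ 8 + ξ ^ 9
    + ξ ^ 10 = 0 := by
  simpa [Finset.sum_range_succ] using isPrimitiveRoot_ξ.geom_sum_eq_zero (by norm_num)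

theorem ν_sq : ν ^ 2 = -ν - 3 := by
  have h : ((Real.sqrt 11 : ℝ) : ℂ) ^ 2 = 11 := by
    exact_mod_cast congrArg Complex.ofReal (Real.sq_sqrt (show (0 : ℝ) ≤ 11 by norm_num))
  simp only [ν]
  linear_combination (Complex.I ^ 2 / 4) * h + (11 / 4) * Complex.I_sq

theorem ξ_pow_im (n : ℕ) : (ξ ^ n).im = Real.sin (n * (2 * Real.pi / 11)) := by
  rw [ξ, ← Complex.exp_nat_mul, ← Complex.exp_ofReal_mul_I_im]
  congr 2
  push_cast
  ring

theorem gauss_period_im_pos : 0 < (ξ + ξ ^ 3 + ξ ^ 4 + ξ ^ 5 + ξ ^ 9).im := by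
  have hπ := Real.pi_pos
  have h1 := ξ_pow_im 1
  rw [pow_one] at h1
  simp only [Complex.add_im, ξ_pow_im, h1]
  have p1 : 0 < Real.sin ((1 : ℕ) * (2 * Real.pi / 11)) := by
    apply Real.sin_pos_of_pos_of_lt_pi <;> push_cast <;> linarith
  have p4 : 0 < Real.sin ((4 : ℕ) * (2 * Real.pi / 11)) := by
    apply Real.sin_pos_of_pos_of_lt_pi <;> push_cast <;> linarith
  have p5 : 0 < Real.sin ((5 : ℕ) * (2 * Real.pi / 11)) := by
    apply Real.sin_pos_of_pos_of_lt_pi <;> push_cast <;> linarith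
  have e3 : Real.sin ((3 : ℕ) * (2 * Real.pi / 11)) = Real.sin (5 * Real.pi / 11) := by
    rw [← Real.sin_pi_sub]
    congr 1
    push_cast
    ring
  have e9 : Real.sin ((9 : ℕ) * (2 * Real.pi / 11)) = -Real.sin (4 * Real.pi / 11) := by
    rw [← Real.sin_two_pi_sub]
    congr 1
    push_cast
    ring
  have hlt : Real.sin (4 * Real.pi / 11) < Real.sin (5 * Real.pi / 11) := by
    apply Real.sin_lt_sin_of_lt_of_le_pi_div_two <;> linarith
  linarith

theorem gauss_period_eq_ν : ξ + ξ ^ 3 + ξ ^ 4 + ξ ^ 5 + ξ ^ 9 = ν := by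
  set S := ξ + ξ ^ 3 + ξ ^ 4 + ξ ^ 5 + ξ ^ 9 with hS
  have h11 := isPrimitiveRoot_ξ.pow_eq_one
  have hquad : S ^ 2 + S + 3 = 0 := by
    have hpow : ∀ k, ξ ^ (k + 11) = ξ ^ k := fun k => by rw [pow_add, h11, mul_one]
    have h12 := hpow 1
    have h13 := hpow 2
    have h14 := hpow 3
    have h18 := hpow 7
    norm_num at h12 h13 h14 h18
    rw [hS]
    linear_combination 2 * h12 + 2 * h13 + 2 * h14 + h18 + 3 * ξ_geom_sum
  have hfac : (S - ν) * (S + 1 + ν) = 0 := by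
    linear_combination hquad - ν_sq
  rcases mul_eq_zero.mp hfac with h | h
  · exact sub_eq_zero.mp h
  · exfalso
    have him := gauss_period_im_pos
    have hν : (0 : ℝ) ≤ ν.im := by
      simp only [ν]
      norm_num [Complex.div_im]
      positivity
    have := congrArg Complex.im h
    simp only [Complex.add_im, Complex.one_im, Complex.zero_im] at this
    rw [← hS] at him
    linarith

theorem one_add_two_mul_ν_ne_zero : (1 + 2 * ν : ℂ) ≠ 0 := by
  intro h
  have : (11 : ℂ) = 0 := by linear_combination (-(1 + 2 * ν)) * h + 4 * ν_sq
  norm_num at this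

/-- The trace from the 11th cyclotomic field to `ℚ(ν)` of `ξ ^ m`. -/
noncomputable def periodSum (m : ℕ) : ℂ := ∑ i : Fin 5, ξ ^ (m * ![1, 9, 3, 4, 5] i)

theorem sum_v_mul_v (k j : ℕ) : ∑ i, v k i * v j i = periodSum (k + j) := by
  simp only [v, periodSum, ← pow_add, ← add_mul]

theorem periodSum_eq_mod (m : ℕ) :
    periodSum m = ∑ i : Fin 5, ξ ^ (m * ![1, 9, 3, 4, 5] i % 11) :=
  Finset.sum_congr rfl fun _ _ => pow_eq_pow_mod _ isPrimitiveRoot_ξ.pow_eq_one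

theorem periodSum_zero : periodSum 0 = 5 := by
  simp [periodSum]

theorem periodSum_of_residue {m : ℕ} (hm : m ∈ ({1, 3, 4, 5} : Finset ℕ)) :
    periodSum m = ν := by
  rw [periodSum_eq_mod, ← gauss_period_eq_ν]
  simp only [Finset.mem_insert, Finset.mem_singleton] at hm
  rcases hm with rfl | rfl | rfl | rfl <;> simp [Fin.sum_univ_five] <;> ring

theorem periodSum_of_nonresidue {m : ℕ} (hm : m ∈ ({2, 6, 7, 8} : Finset ℕ)) :
    periodSum m = -1 - ν := by
  rw [periodSum_eq_mod, ← gauss_period_eq_ν]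
  simp only [Finset.mem_insert, Finset.mem_singleton] at hm
  rcases hm with rfl | rfl | rfl | rfl <;> simp [Fin.sum_univ_five] <;>
    linear_combination ξ_geom_sum

theorem sum_v_mul_combination (k : ℕ) (c : Fin 4 → ℂ) (c₄ : ℂ) :
    ∑ i, v k i *
        ((∑ j : Fin 4, (c j / (1 + 2 * ν)) • (v j.val - v (j.val + 1))) + c₄ • v 0) i
      = (∑ j : Fin 4, c j * ((periodSum (k + j) - periodSum (k + j + 1)) / (1 + 2 * ν)))
        + c₄ * periodSum k := by
  rw [← add_zero k, ← sum_v_mul_v]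
  simp only [add_zero, add_assoc, ← sum_v_mul_v, Fin.sum_univ_four, Fin.sum_univ_five,
    Pi.add_apply, Pi.smul_apply, Pi.sub_apply, smul_eq_mul]
  ring

/-- The matrix of the forms `ℓ_k` in the proposed basis of `Λ₄`. -/
theorem forms_of_combination (c : Fin 4 → ℂ) (c₄ : ℂ) (x : Fin 5 → ℂ)
    (hx : x = (∑ j : Fin 4, (c j / (1 + 2 * ν)) • (v j.val - v (j.val + 1))) + c₄ • v 0) :
    ∑ i, v 0 i * x i = (-1 - ν) * c 0 + c 1 - c 2 + 5 * c₄ ∧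
    ∑ i, v 1 i * x i = c 0 - c 1 + ν * c₄ ∧
    ∑ i, v 2 i * x i = -c 0 + c 3 + (-1 - ν) * c₄ ∧
    ∑ i, v 3 i * x i = c 2 + ν * c₄ ∧
    ∑ i, v 4 i * x i = c 1 + ν * c₄ := by
  subst hx
  have h := one_add_two_mul_ν_ne_zero
  have r := @periodSum_of_residue
  have n := @periodSum_of_nonresidue
  have d0 : (5 - ν) / (1 + 2 * ν) = -1 - ν := by
    rw [div_eq_iff h]; linear_combination 2 * ν_sq
  have d1 : (ν - (-1 - ν)) / (1 + 2 * ν) = 1 := by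
    rw [div_eq_iff h]; ring
  have d2 : (-1 - ν - ν) / (1 + 2 * ν) = -1 := by
    rw [div_eq_iff h]; ring
  refine ⟨?_, ?_, ?_, ?_, ?_⟩ <;> rw [sum_v_mul_combination] <;>
    simp [Fin.sum_univ_four, periodSum_zero, r (m := 1), r (m := 3), r (m := 4), r (m := 5), n (m := 2),
      n (m := 6), n (m := 7), n (m := 8), d0, d1, d2] <;> ring

theorem eq_of_forms_eq {x z : Fin 5 → ℂ}
    (h : ∀ k : Fin 5, ∑ i, v k.val i * x i = ∑ i, v k.val i * z i) : x = z := by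
  have hinj : Function.Injective fun i : Fin 5 => ξ ^ (![1, 9, 3, 4, 5] i) := by
    intro i j hij
    have hlt : ∀ i : Fin 5, ![1, 9, 3, 4, 5] i < 11 := by decide
    have := isPrimitiveRoot_ξ.pow_inj (hlt i) (hlt j) hij
    have hidx : ∀ i j : Fin 5, ![1, 9, 3, 4, 5] i = ![1, 9, 3, 4, 5] j → i = j := by decide
    exact hidx i j this
  rw [← sub_eq_zero]
  refine Matrix.eq_zero_of_forall_pow_sum_mul_pow_eq_zero hinj fun k => ?_
  rw [← sub_eq_zero.mpr (h k), ← Finset.sum_sub_distrib]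
  refine Finset.sum_congr rfl fun i _ => ?_
  rw [v, Pi.sub_apply, ← pow_mul, mul_comm k.val]
  ring

/-- `Zν` as a subring of `ℂ`. -/
noncomputable def Zνring : Subring ℂ where
  carrier := Zν
  zero_mem' := ⟨0, 0, by simp⟩
  one_mem' := ⟨1, 0, by simp⟩
  add_mem' := by
    rintro _ _ ⟨a, b, rfl⟩ ⟨a', b', rfl⟩
    exact ⟨a + a', b + b', by push_cast; ring⟩
  neg_mem' := by
    rintro _ ⟨a, b, rfl⟩
    exact ⟨-a, -b, by push_cast; ring⟩
  mul_mem' := by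
    rintro _ _ ⟨a, b, rfl⟩ ⟨a', b', rfl⟩
    refine ⟨a * a' - 3 * (b * b'), a * b' + b * a' - b * b', ?_⟩
    push_cast
    linear_combination (b * b' : ℂ) * ν_sq

theorem ν_mem : ν ∈ Zνring := ⟨0, 1, by simp⟩

/-- the lattice Λ₄ = {z ∈ ℂ⁵ : ℓ_k(z) ∈ ℤ[ν], 0 ≤ k ≤ 4}, where
ℓ_k(z) = ξ^k z₁ + ξ^{9k} z₂ + ξ^{3k} z₃ + ξ^{4k} z₄ + ξ^{5k} z₅, equals the ℤ[ν]-module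
Σ_{k=0}^{3} (ℤ[ν]/(1+2ν))(v_k − v_{k+1}) + ℤ[ν]v₀. -/
theorem lattice_Lambda4_eq :
    {z : Fin 5 → ℂ | ∀ k : Fin 5, (∑ i, v k.val i * z i) ∈ Zν}
      = {x | ∃ c : Fin 4 → ℂ, ∃ c₄ : ℂ, (∀ j, c j ∈ Zν) ∧ c₄ ∈ Zν ∧
          x = (∑ j : Fin 4, (c j / (1 + 2 * ν)) • (v j.val - v (j.val + 1))) + c₄ • v 0} := by
  have hν := ν_mem
  have hneg : -1 - ν ∈ Zνring := sub_mem (neg_mem (one_mem _)) hν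
  have hfive : (5 : ℂ) ∈ Zνring := ofNat_mem _ 5
  ext z
  simp only [Set.mem_ofPred_eq]
  constructor
  · intro hz
    set w : Fin 5 → ℂ := fun k => ∑ i, v k.val i * z i with hw
    replace hz : ∀ k, w k ∈ Zνring := hz
    set c₄ : ℂ := -w 0 + (-1 - ν) * (w 1 + w 4) + w 4 - w 3 with hc₄
    have hm : c₄ ∈ Zνring :=
      sub_mem (add_mem (add_mem (neg_mem (hz 0)) (mul_mem hneg (add_mem (hz 1) (hz 4))))
        (hz 4)) (hz 3)
    have hνm := mul_mem hν hm
    set c : Fin 4 → ℂ := ![w 1 + w 4 - (ν * c₄ + ν * c₄), w 4 - ν * c₄, w 3 - ν * c₄,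
      w 2 + w 1 + w 4 + (c₄ - ν * c₄)] with hc
    refine ⟨c, c₄, ?_, hm, ?_⟩
    · change ∀ j, c j ∈ Zνring
      intro j
      fin_cases j
      · exact sub_mem (add_mem (hz 1) (hz 4)) (add_mem hνm hνm)
      · exact sub_mem (hz 4) hνm
      · exact sub_mem (hz 3) hνm
      · exact add_mem (add_mem (add_mem (hz 2) (hz 1)) (hz 4)) (sub_mem hm hνm)
    · symm
      obtain ⟨h0, h1, h2, h3, h4⟩ := forms_of_combination c c₄ _ rfl
      apply eq_of_forms_eq
      intro k
      change _ = w k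
      have c0 : c 0 = w 1 + w 4 - (ν * c₄ + ν * c₄) := rfl
      have c1 : c 1 = w 4 - ν * c₄ := rfl
      have c2 : c 2 = w 3 - ν * c₄ := rfl
      have c3 : c 3 = w 2 + w 1 + w 4 + (c₄ - ν * c₄) := rfl
      clear_value c w
      rw [c0, c1, c2] at h0
      rw [c0, c1] at h1
      rw [c0, c3] at h2
      rw [c2] at h3
      rw [c1] at h4
      fin_cases k
      · refine h0.trans ?_
        change _ = w 0
        linear_combination (2 * c₄) * ν_sq - hc₄
      · exact h1.trans (by change _ = w 1; ring)
      · exact h2.trans (by change _ = w 2; ring)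
      · exact h3.trans (by change _ = w 3; ring)
      · exact h4.trans (by change _ = w 4; ring)
  · rintro ⟨c, c₄, hc, hc₄, hx⟩ k
    replace hc : ∀ j, c j ∈ Zνring := hc
    replace hc₄ : c₄ ∈ Zνring := hc₄
    obtain ⟨h0, h1, h2, h3, h4⟩ := forms_of_combination c c₄ z hx
    change _ ∈ Zνring
    fin_cases k
    · exact h0 ▸ add_mem (sub_mem (add_mem (mul_mem hneg (hc 0)) (hc 1)) (hc 2))
        (mul_mem hfive hc₄)
    · exact h1 ▸ add_mem (sub_mem (hc 0) (hc 1)) (mul_mem hν hc₄)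
    · exact h2 ▸ add_mem (add_mem (neg_mem (hc 0)) (hc 3)) (mul_mem hneg hc₄)
    · exact h3 ▸ add_mem (hc 2) (mul_mem hν hc₄)
    · exact h4 ▸ add_mem (hc 1) (mul_mem hν hc₄)
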